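/- arXiv:2210.13847 — 3 statements merged into one kernel-verified Lean document; each statement's English description precedes it below -/
import Mathlib

section
/- Fix d ∈ ℕ, d ≥ 1, and ε, δ, R > 0. Let η ∈ [εδ, ε(1+δ)], let m be a probability measure on ℝᵈ with m(B_R) ≥ 1/2, and let σ̄: ℝᵈ → ℝ^{d×d} be measurable, taking values in the positive semidefinite matrices, with ∫ ‖σ̄(y)‖² m(dy) = 1. Define, for x ∈ ℝᵈ, the matrix σ̃²(x) := (∫ σ̄(y)² g_η(x−y) m(dy)) / (∫ g_η(x−y) m(dy)). Then for every compact set K ⊆ ℝᵈ there exist constants C_K, L_K > 0, depending only on K, R, ε, δ and d (and not on m, σ̄ or η), such that ‖σ̃²(x)‖ ≤ C_K for all x ∈ K, and ‖σ̃²(x) − σ̃²(x')‖ ≤ L_K |x − x'| for all x, x' ∈ K. -/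
open MeasureTheory Set
open scoped ENNReal NNReal

noncomputable section

abbrev Euc (d : ℕ) : Type := EuclideanSpace ℝ (Fin d)

/-- Frobenius (Hilbert–Schmidt) norm of a real matrix. -/
def frob {d : ℕ} (A : Matrix (Fin d) (Fin d) ℝ) : ℝ :=
  Real.sqrt (∑ i, ∑ j, (A i j) ^ 2)

/-- Density of the centered Gaussian measure on `ℝ^d` with covariance `η • id`. -/
def gaussDensity (d : ℕ) (η : ℝ) (z : Euc d) : ℝ :=
  (2 * Real.pi * η) ^ (-(d : ℝ) / 2) * Real.exp (-‖z‖ ^ 2 / (2 * η))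

/-- The Gaussian-mollified squared diffusion coefficient
`σ̃²(x) = (∫ σ̄(y)² g_η(x−y) m(dy)) / (∫ g_η(x−y) m(dy))`. -/
def sigmaTildeSq (d : ℕ) (η : ℝ) (m : Measure (Euc d))
    (σb : Euc d → Matrix (Fin d) (Fin d) ℝ) (x : Euc d) : Matrix (Fin d) (Fin d) ℝ :=
  (∫ y, gaussDensity d η (x - y) ∂m)⁻¹ •
    Matrix.of fun i j => ∫ y, (σb y * σb y) i j * gaussDensity d η (x - y) ∂m

/-- The map `t ↦ exp (-t ^ 2)` is 1-Lipschitz. -/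
theorem lipschitzWith_exp_neg_sq : LipschitzWith 1 fun t : ℝ => Real.exp (-t ^ 2) := by
  have hder : ∀ t : ℝ, HasDerivAt (fun t : ℝ => Real.exp (-t ^ 2))
      (Real.exp (-t ^ 2) * (-(2 * t))) t := by
    intro t
    have h : HasDerivAt (fun t : ℝ => -t ^ 2) (-(2 * t)) t := by
      simpa using (hasDerivAt_pow 2 t).fun_neg
    exact h.exp
  refine lipschitzWith_of_nnnorm_deriv_le (fun t => (hder t).differentiableAt) fun t => ?_
  rw [← NNReal.coe_le_coe, coe_nnnorm, (hder t).deriv, Real.norm_eq_abs, abs_mul,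
    abs_of_pos (Real.exp_pos _), abs_neg, Real.exp_neg, NNReal.coe_one,
    inv_mul_le_iff₀ (Real.exp_pos _), mul_one]
  calc |2 * t| ≤ t ^ 2 + 1 := by
        rw [abs_le]
        constructor <;> nlinarith [sq_nonneg (t - 1), sq_nonneg (t + 1)]
    _ ≤ Real.exp (t ^ 2) := Real.add_one_le_exp _

/-- The Gaussian kernel without its normalising prefactor. -/
def gaussKernel (d : ℕ) (η : ℝ) (z : Euc d) : ℝ := Real.exp (-‖z‖ ^ 2 / (2 * η))

section Kernel

variable {d : ℕ} {η : ℝ}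

theorem gaussKernel_pos (z : Euc d) : 0 < gaussKernel d η z := Real.exp_pos _

theorem gaussKernel_le_one (hη : 0 < η) (z : Euc d) : gaussKernel d η z ≤ 1 := by
  unfold gaussKernel
  rw [Real.exp_le_one_iff, neg_div]
  exact neg_nonpos.2 (by positivity)

theorem abs_gaussKernel_le_one (hη : 0 < η) (z : Euc d) : |gaussKernel d η z| ≤ 1 := by
  rw [abs_of_pos (gaussKernel_pos z)]
  exact gaussKernel_le_one hη z

theorem continuous_gaussKernel : Continuous (gaussKernel d η) := by
  unfold gaussKernel
  fun_prop

theorem abs_gaussKernel_sub_le {κ : ℝ} (hκ : 0 < κ) (hη : κ ≤ η) (z w : Euc d) :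
    |gaussKernel d η z - gaussKernel d η w| ≤ (√(2 * κ))⁻¹ * ‖z - w‖ := by
  have hη0 : 0 < η := hκ.trans_le hη
  have hs : 0 < √(2 * η) := by positivity
  have heq : ∀ z : Euc d, gaussKernel d η z = Real.exp (-(‖z‖ / √(2 * η)) ^ 2) := by
    intro z
    rw [gaussKernel, div_pow, Real.sq_sqrt (by positivity), neg_div]
  have h := lipschitzWith_exp_neg_sq.dist_le_mul (‖z‖ / √(2 * η)) (‖w‖ / √(2 * η))
  rw [Real.dist_eq, Real.dist_eq, NNReal.coe_one, one_mul, ← sub_div, abs_div, abs_of_pos hs] at h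
  rw [heq, heq]
  refine h.trans ?_
  rw [div_eq_inv_mul]
  gcongr
  exact abs_norm_sub_norm_le z w

theorem le_integral_gaussKernel {κ r R : ℝ} (hκ : 0 < κ) (hη : κ ≤ η) {m : Measure (Euc d)}
    [IsProbabilityMeasure m] (hm : (1 / 2 : ℝ≥0∞) ≤ m (Metric.closedBall 0 R)) {x : Euc d}
    (hx : ‖x‖ ≤ r) :
    Real.exp (-(r + R) ^ 2 / (2 * κ)) / 2 ≤ ∫ y, gaussKernel d η (x - y) ∂m := by
  have hη0 : 0 < η := hκ.trans_le hη
  have hint : Integrable (fun y => gaussKernel d η (x - y)) m :=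
    .of_bound (continuous_gaussKernel.comp (by fun_prop)).aestronglyMeasurable 1
      (ae_of_all _ fun y => abs_gaussKernel_le_one hη0 _)
  have hhalf : (1 / 2 : ℝ) ≤ m.real (Metric.closedBall 0 R) := by
    have := ENNReal.toReal_mono (measure_ne_top m _) hm
    simpa [Measure.real] using this
  have hlow : ∀ y ∈ Metric.closedBall (0 : Euc d) R,
      Real.exp (-(r + R) ^ 2 / (2 * κ)) ≤ gaussKernel d η (x - y) := by
    intro y hy
    have hxy : ‖x - y‖ ≤ r + R :=
      (norm_sub_le x y).trans (add_le_add hx (by simpa using hy))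
    unfold gaussKernel
    rw [Real.exp_le_exp, neg_div, neg_div, neg_le_neg_iff]
    gcongr
  calc Real.exp (-(r + R) ^ 2 / (2 * κ)) / 2
      ≤ Real.exp (-(r + R) ^ 2 / (2 * κ)) * m.real (Metric.closedBall 0 R) := by
        rw [div_eq_mul_one_div]
        gcongr
    _ ≤ ∫ y in Metric.closedBall 0 R, gaussKernel d η (x - y) ∂m :=
        setIntegral_ge_of_const_le_real measurableSet_closedBall (measure_ne_top _ _) hlow
          hint.integrableOn
    _ ≤ ∫ y, gaussKernel d η (x - y) ∂m :=
        setIntegral_le_integral hint (ae_of_all _ fun y => (gaussKernel_pos _).le)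

theorem integrable_mul_gaussKernel (hη : 0 < η) {m : Measure (Euc d)} {f : Euc d → ℝ}
    (hf : Integrable f m) (x : Euc d) : Integrable (fun y => f y * gaussKernel d η (x - y)) m :=
  hf.mul_bdd (c := 1) (continuous_gaussKernel.comp (by fun_prop)).aestronglyMeasurable
    (ae_of_all _ fun y => abs_gaussKernel_le_one hη _)

theorem abs_integral_mul_gaussKernel_le (hη : 0 < η) {m : Measure (Euc d)} {f : Euc d → ℝ}
    (hf : Integrable f m) (hf1 : ∫ y, |f y| ∂m ≤ 1) (x : Euc d) :
    |∫ y, f y * gaussKernel d η (x - y) ∂m| ≤ 1 := by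
  rw [← Real.norm_eq_abs]
  refine (norm_integral_le_of_norm_le hf.abs (ae_of_all _ fun y => ?_)).trans hf1
  rw [Real.norm_eq_abs, abs_mul]
  exact mul_le_of_le_one_right (abs_nonneg _) (abs_gaussKernel_le_one hη _)

theorem abs_integral_mul_gaussKernel_sub_le {κ : ℝ} (hκ : 0 < κ) (hη : κ ≤ η)
    {m : Measure (Euc d)} {f : Euc d → ℝ} (hf : Integrable f m) (hf1 : ∫ y, |f y| ∂m ≤ 1)
    (x x' : Euc d) :
    |∫ y, f y * gaussKernel d η (x - y) ∂m - ∫ y, f y * gaussKernel d η (x' - y) ∂m|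
      ≤ (√(2 * κ))⁻¹ * ‖x - x'‖ := by
  have hη0 : 0 < η := hκ.trans_le hη
  rw [← integral_sub (integrable_mul_gaussKernel hη0 hf x) (integrable_mul_gaussKernel hη0 hf x'),
    ← Real.norm_eq_abs]
  refine (norm_integral_le_of_norm_le (hf.abs.mul_const ((√(2 * κ))⁻¹ * ‖x - x'‖))
    (ae_of_all _ fun y => ?_)).trans ?_
  · rw [← mul_sub, Real.norm_eq_abs, abs_mul]
    gcongr
    simpa using abs_gaussKernel_sub_le hκ hη (x - y) (x' - y)
  · rw [integral_mul_const]
    exact mul_le_of_le_one_left (by positivity) hf1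

end Kernel

theorem abs_inv_mul_le {a D N : ℝ} (ha : 0 < a) (hD : a ≤ D) (hN : |N| ≤ 1) :
    |D⁻¹ * N| ≤ a⁻¹ := by
  have hD0 : 0 < D := ha.trans_le hD
  rw [abs_mul, abs_of_pos (inv_pos.2 hD0)]
  calc D⁻¹ * |N| ≤ a⁻¹ * 1 := by gcongr
    _ = a⁻¹ := mul_one _

/-- Quotient estimate: numerators bounded by one, denominators bounded below by `a`. -/
theorem abs_inv_mul_sub_inv_mul_le {a D D' N N' e : ℝ} (ha : 0 < a) (hD : a ≤ D) (hD' : a ≤ D')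
    (hN' : |N'| ≤ 1) (hDD : |D - D'| ≤ e) (hNN : |N - N'| ≤ e) :
    |D⁻¹ * N - D'⁻¹ * N'| ≤ (a⁻¹ + a⁻¹ * a⁻¹) * e := by
  have hD0 : 0 < D := ha.trans_le hD
  have hD'0 : 0 < D' := ha.trans_le hD'
  have he : 0 ≤ e := (abs_nonneg _).trans hNN
  have heq : D⁻¹ * N - D'⁻¹ * N' = D⁻¹ * (N - N') - D⁻¹ * (D'⁻¹ * N') * (D - D') := by
    field_simp
    ring
  have h1 : |D⁻¹ * (N - N')| ≤ a⁻¹ * e := by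
    rw [abs_mul, abs_of_pos (inv_pos.2 hD0)]
    gcongr
  have h2 : |D⁻¹ * (D'⁻¹ * N') * (D - D')| ≤ a⁻¹ * a⁻¹ * e := by
    rw [abs_mul, abs_mul, abs_of_pos (inv_pos.2 hD0)]
    have := abs_inv_mul_le ha hD' hN'
    gcongr
  rw [heq, add_mul]
  exact (abs_sub _ _).trans (add_le_add h1 h2)

section Frobenius

variable {d : ℕ}

theorem frob_sq (A : Matrix (Fin d) (Fin d) ℝ) : frob A ^ 2 = ∑ i, ∑ j, A i j ^ 2 :=
  Real.sq_sqrt (by positivity)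

theorem frob_le_of_abs_le {A : Matrix (Fin d) (Fin d) ℝ} {b : ℝ} (hb : 0 ≤ b)
    (h : ∀ i j, |A i j| ≤ b) : frob A ≤ d * b := by
  refine Real.sqrt_le_iff.2 ⟨by positivity, ?_⟩
  calc ∑ i, ∑ j, A i j ^ 2 ≤ ∑ _i : Fin d, ∑ _j : Fin d, b ^ 2 :=
        Finset.sum_le_sum fun i _ => Finset.sum_le_sum fun j _ =>
          sq_le_sq' (abs_le.1 (h i j)).1 (abs_le.1 (h i j)).2
    _ = (d * b) ^ 2 := by simp; ring

theorem abs_mul_self_apply_le (A : Matrix (Fin d) (Fin d) ℝ) (i j : Fin d) :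
    |(A * A) i j| ≤ frob A ^ 2 := by
  have hrow : ∑ k, A i k ^ 2 ≤ frob A ^ 2 := by
    rw [frob_sq]
    exact Finset.single_le_sum (f := fun i => ∑ k, A i k ^ 2)
      (fun _ _ => by positivity) (Finset.mem_univ i)
  have hcol : ∑ k, A k j ^ 2 ≤ frob A ^ 2 := by
    rw [frob_sq]
    exact Finset.sum_le_sum fun k _ =>
      Finset.single_le_sum (f := fun j => A k j ^ 2) (fun _ _ => by positivity) (Finset.mem_univ j)
  have hprod : |(A * A) i j| ≤ ∑ k, (A i k ^ 2 + A k j ^ 2) / 2 := by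
    rw [Matrix.mul_apply]
    refine (Finset.abs_sum_le_sum_abs _ _).trans (Finset.sum_le_sum fun k _ => ?_)
    rw [abs_le]
    constructor <;> nlinarith [sq_nonneg (A i k - A k j), sq_nonneg (A i k + A k j)]
  rw [← Finset.sum_div, Finset.sum_add_distrib] at hprod
  linarith

end Frobenius

theorem sigmaTildeSq_apply {d : ℕ} {η : ℝ} (hη : 0 < η) (m : Measure (Euc d))
    (σb : Euc d → Matrix (Fin d) (Fin d) ℝ) (x : Euc d) (i j : Fin d) :
    sigmaTildeSq d η m σb x i j = (∫ y, gaussKernel d η (x - y) ∂m)⁻¹ *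
      ∫ y, (σb y * σb y) i j * gaussKernel d η (x - y) ∂m := by
  have hc : (2 * Real.pi * η) ^ (-(d : ℝ) / 2) ≠ 0 := by positivity
  simp only [sigmaTildeSq, Matrix.smul_apply, Matrix.of_apply, smul_eq_mul, gaussDensity,
    ← gaussKernel.eq_1, mul_left_comm _ ((2 * Real.pi * η) ^ (-(d : ℝ) / 2)), integral_const_mul,
    mul_inv]
  field_simp

/-- Uniform local boundedness and local Lipschitz continuity of the mollified squared
diffusion coefficient (Lemma 2.2): the constants depend only on `K`, `R`, `ε`, `δ` and `d`,
not on `η ∈ [εδ, ε(1+δ)]`, `m` or `σ̄`. -/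
theorem statement7 (d : ℕ) (hd : 1 ≤ d) (ε δ R : ℝ) (hε : 0 < ε) (hδ : 0 < δ) (hR : 0 < R)
    (K : Set (Euc d)) (hK : IsCompact K) :
    ∃ C L : ℝ, 0 < C ∧ 0 < L ∧
      ∀ η : ℝ, η ∈ Icc (ε * δ) (ε * (1 + δ)) →
      ∀ m : Measure (Euc d), IsProbabilityMeasure m →
        (1 / 2 : ℝ≥0∞) ≤ m (Metric.closedBall 0 R) →
      ∀ σb : Euc d → Matrix (Fin d) (Fin d) ℝ,
        (∀ i j, Measurable fun y => σb y i j) →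
        (∀ y, (σb y).PosSemidef) →
        (∫ y, frob (σb y) ^ 2 ∂m) = 1 →
        (∀ x ∈ K, frob (sigmaTildeSq d η m σb x) ≤ C) ∧
        (∀ x ∈ K, ∀ x' ∈ K,
          frob (sigmaTildeSq d η m σb x - sigmaTildeSq d η m σb x') ≤ L * ‖x - x'‖) := by
  obtain ⟨r, hr⟩ := hK.isBounded.exists_norm_le
  set κ := ε * δ
  have hκ : 0 < κ := mul_pos hε hδ
  set a := Real.exp (-(r + R) ^ 2 / (2 * κ)) / 2
  have ha : 0 < a := by positivity
  set Λ := (√(2 * κ))⁻¹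
  have hΛ : 0 < Λ := by positivity
  have hd0 : (0 : ℝ) < d := by exact_mod_cast hd
  refine ⟨d * a⁻¹, d * ((a⁻¹ + a⁻¹ * a⁻¹) * Λ), by positivity, by positivity, ?_⟩
  intro η hη m _ hm σb hmeas _ hσ
  have hη0 : 0 < η := hκ.trans_le hη.1
  have hfrob : Integrable (fun y => frob (σb y) ^ 2) m :=
    .of_integral_ne_zero (by rw [hσ]; exact one_ne_zero)
  have hint : ∀ i j, Integrable (fun y => (σb y * σb y) i j) m := fun i j =>
    hfrob.mono' (by
      simp only [Matrix.mul_apply]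
      exact (Finset.measurable_fun_sum _ fun k _ =>
        (hmeas i k).mul (hmeas k j)).aestronglyMeasurable)
      (ae_of_all _ fun y => abs_mul_self_apply_le (σb y) i j)
  have hle : ∀ i j, ∫ y, |(σb y * σb y) i j| ∂m ≤ 1 := fun i j =>
    (integral_mono (hint i j).abs hfrob fun y => abs_mul_self_apply_le (σb y) i j).trans hσ.le
  have hN := fun i j => abs_integral_mul_gaussKernel_le hη0 (hint i j) (hle i j)
  have hD : ∀ x ∈ K, a ≤ ∫ y, gaussKernel d η (x - y) ∂m := fun x hx =>
    le_integral_gaussKernel hκ hη.1 hm (hr x hx)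
  refine ⟨fun x hx => frob_le_of_abs_le (by positivity) fun i j => ?_, fun x hx x' hx' => ?_⟩
  · rw [sigmaTildeSq_apply hη0]
    exact abs_inv_mul_le ha (hD x hx) (hN i j x)
  · rw [mul_assoc, mul_assoc]
    refine frob_le_of_abs_le (by positivity) fun i j => ?_
    rw [Matrix.sub_apply, sigmaTildeSq_apply hη0, sigmaTildeSq_apply hη0]
    have hDD : |∫ y, gaussKernel d η (x - y) ∂m - ∫ y, gaussKernel d η (x' - y) ∂m|
        ≤ Λ * ‖x - x'‖ := by
      have h := abs_integral_mul_gaussKernel_sub_le hκ hη.1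
        (integrable_const (μ := m) (1 : ℝ)) (by simp) x x'
      simpa only [one_mul] using h
    exact abs_inv_mul_sub_inv_mul_le ha (hD x hx) (hD x' hx') (hN i j x') hDD
      (abs_integral_mul_gaussKernel_sub_le hκ hη.1 (hint i j) (hle i j) x x')
end
end

section
/- Let O ⊆ ℝᵈ and let θ: O → ℝ^{d×d} take values in the positive semidefinite matrices, and suppose the map x ↦ θ(x)² is Lipschitz continuous on O with Lipschitz constant L (with respect to the Frobenius norm). Then θ is 1/2-Hölder continuous on O: there is a constant C, depending only on d and L, such that ‖θ(x) − θ(y)‖ ≤ C |x − y|^{1/2} for all x, y ∈ O. -/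
open MeasureTheory Set
open scoped ENNReal NNReal

noncomputable section

open Matrix in
theorem Matrix.IsHermitian.sum_sq_eq_sum_eigenvalues_sq {n : Type*} [Fintype n] [DecidableEq n]
    {D : Matrix n n ℝ} (hD : D.IsHermitian) :
    ∑ i, ∑ j, (D i j) ^ 2 = ∑ i, hD.eigenvalues i ^ 2 := by
  have h_entries : (D * D).trace = ∑ i, ∑ j, (D i j) ^ 2 := by
    simp only [trace, diag_apply, mul_apply]
    refine Finset.sum_congr rfl fun i _ => Finset.sum_congr rfl fun j _ => ?_
    have h := hD.apply i j
    rw [star_trivial] at h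
    rw [h, sq]
  have h_spec : (D * D).trace = ∑ i, hD.eigenvalues i ^ 2 := by
    conv_lhs => rw [hD.spectral_theorem, ← map_mul, Unitary.conjStarAlgAut_apply,
      trace_mul_comm, ← mul_assoc, Unitary.coe_star_mul_self, one_mul,
      diagonal_mul_diagonal, trace_diagonal]
    simp [sq]
  rw [← h_entries, h_spec]

open Matrix in
theorem abs_dotProduct_mulVec_le_frob {d : ℕ} (M : Matrix (Fin d) (Fin d) ℝ) {v : Fin d → ℝ}
    (hv : v ⬝ᵥ v = 1) : |v ⬝ᵥ (M *ᵥ v)| ≤ frob M := by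
  refine Real.abs_le_sqrt ?_
  have hv2 : ∑ p : Fin d × Fin d, (v p.1 * v p.2) ^ 2 = 1 := by
    have h : ∑ i, v i ^ 2 = 1 := by simpa [dotProduct, sq] using hv
    simp_rw [Fintype.sum_prod_type, mul_pow, ← Finset.mul_sum, h, mul_one, h]
  have h_form : v ⬝ᵥ (M *ᵥ v) = ∑ p : Fin d × Fin d, (v p.1 * v p.2) * M p.1 p.2 := by
    simp only [Fintype.sum_prod_type, dotProduct, mulVec, Finset.mul_sum]
    exact Finset.sum_congr rfl fun i _ => Finset.sum_congr rfl fun j _ => by ring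
  have h_cs := Finset.sum_mul_sq_le_sq_mul_sq (Finset.univ : Finset (Fin d × Fin d))
    (fun p => v p.1 * v p.2) (fun p => M p.1 p.2)
  rw [← h_form, hv2, one_mul, Fintype.sum_prod_type] at h_cs
  exact h_cs

open Matrix in
/-- At an eigenvector of `A - B`, the quadratic form of `A * A - B * B` is the eigenvalue times the
quadratic form of `A + B`, which dominates the absolute value of the eigenvalue. -/
theorem eigenvalue_sub_sq_le_frob {d : ℕ} {A B : Matrix (Fin d) (Fin d) ℝ}
    (hA : A.PosSemidef) (hB : B.PosSemidef) {v : Fin d → ℝ} {l : ℝ} (hv : v ⬝ᵥ v = 1)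
    (hl : (A - B) *ᵥ v = l • v) : l ^ 2 ≤ frob (A * A - B * B) := by
  have ha : 0 ≤ v ⬝ᵥ (A *ᵥ v) := by simpa using hA.dotProduct_mulVec_nonneg v
  have hb : 0 ≤ v ⬝ᵥ (B *ᵥ v) := by simpa using hB.dotProduct_mulVec_nonneg v
  have h_sub : l = v ⬝ᵥ (A *ᵥ v) - v ⬝ᵥ (B *ᵥ v) := by
    rw [← dotProduct_sub, ← sub_mulVec, hl, dotProduct_smul, hv, smul_eq_mul, mul_one]
  have hD : v ᵥ* (A - B) = l • v := by
    have h : (A - B)ᵀ = A - B := by simpa using (hA.1.sub hB.1).eq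
    rw [← mulVec_transpose, h, hl]
  have h_sq : v ⬝ᵥ ((A * A - B * B) *ᵥ v) = l * (v ⬝ᵥ (A *ᵥ v) + v ⬝ᵥ (B *ᵥ v)) := by
    have h : A * A - B * B = A * (A - B) + (A - B) * B := by noncomm_ring
    rw [h, add_mulVec, dotProduct_add, ← mulVec_mulVec, ← mulVec_mulVec, hl, mulVec_smul,
      dotProduct_smul, dotProduct_mulVec v (A - B), hD, smul_dotProduct]
    simp only [smul_eq_mul]
    ring
  have h_abs : |l| ≤ v ⬝ᵥ (A *ᵥ v) + v ⬝ᵥ (B *ᵥ v) := by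
    rw [abs_le]; constructor <;> linarith
  calc l ^ 2 = |l| * |l| := by rw [← sq, sq_abs]
    _ ≤ |l| * (v ⬝ᵥ (A *ᵥ v) + v ⬝ᵥ (B *ᵥ v)) := by gcongr
    _ = |v ⬝ᵥ ((A * A - B * B) *ᵥ v)| := by
      rw [h_sq, abs_mul, abs_of_nonneg (add_nonneg ha hb)]
    _ ≤ _ := abs_dotProduct_mulVec_le_frob _ hv

/-- A form of the Powers–Størmer inequality. -/
theorem frob_sub_le_sqrt {d : ℕ} {A B : Matrix (Fin d) (Fin d) ℝ}
    (hA : A.PosSemidef) (hB : B.PosSemidef) :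
    frob (A - B) ≤ Real.sqrt (d * frob (A * A - B * B)) := by
  have hD := hA.1.sub hB.1
  refine Real.sqrt_le_sqrt ?_
  rw [hD.sum_sq_eq_sum_eigenvalues_sq]
  have h_each (i : Fin d) : hD.eigenvalues i ^ 2 ≤ frob (A * A - B * B) := by
    refine eigenvalue_sub_sq_le_frob hA hB ?_ (hD.mulVec_eigenvectorBasis i)
    have h := hD.eigenvectorBasis.inner_eq_one i
    rwa [EuclideanSpace.inner_eq_star_dotProduct, star_trivial] at h
  simpa using Finset.sum_le_sum fun i (_ : i ∈ Finset.univ) => h_each i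

/-- If `θ` is positive-semidefinite-valued and `θ²` is `L`-Lipschitz, then `θ` is `1/2`-Hölder
continuous, with constant depending only on `d` and `L` (Remark 5.4 (i)). -/
theorem statement9 (d : ℕ) (L : ℝ) (hL : 0 ≤ L) :
    ∃ C : ℝ, 0 < C ∧
      ∀ (O : Set (Euc d)) (θ : Euc d → Matrix (Fin d) (Fin d) ℝ),
        (∀ x ∈ O, (θ x).PosSemidef) →
        (∀ x ∈ O, ∀ y ∈ O, frob (θ x * θ x - θ y * θ y) ≤ L * ‖x - y‖) →
        ∀ x ∈ O, ∀ y ∈ O, frob (θ x - θ y) ≤ C * Real.sqrt ‖x - y‖ := by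
  refine ⟨Real.sqrt (d * L) + 1, by positivity, fun O θ hpsd hlip x hx y hy => ?_⟩
  calc frob (θ x - θ y) ≤ Real.sqrt (d * frob (θ x * θ x - θ y * θ y)) :=
        frob_sub_le_sqrt (hpsd x hx) (hpsd y hy)
    _ ≤ Real.sqrt (d * (L * ‖x - y‖)) := by gcongr; exact hlip x hx y hy
    _ = Real.sqrt (d * L) * Real.sqrt ‖x - y‖ := by
      rw [← mul_assoc, Real.sqrt_mul (by positivity)]
    _ ≤ (Real.sqrt (d * L) + 1) * Real.sqrt ‖x - y‖ := by gcongr; linarith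
end
end

section
/- Let O ⊆ ℝᵈ, δ > 0, and let θ: O → ℝ^{d×d} take values in the positive semidefinite matrices with θ(x)² ≥ δ·id for all x ∈ O (all eigenvalues of θ(x)² bounded below by δ). Suppose the map x ↦ θ(x)² is Lipschitz continuous on O with Lipschitz constant L (Frobenius norm). Then θ is Lipschitz continuous on O, with a Lipschitz constant depending only on δ and L. -/
open MeasureTheory Set
open scoped ENNReal NNReal

noncomputable section

/-- If a positive semidefinite real matrix `A` satisfies `A² ≥ s²`, then `A ≥ s`. -/
theorem posSemidef_sub_smul_one_of_sq {n : Type*} [Fintype n] [DecidableEq n] {A : Matrix n n ℝ}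
    {s : ℝ} (hA : A.PosSemidef)
    (hA2 : (A * A - (s * s) • (1 : Matrix n n ℝ)).PosSemidef) :
    (A - s • (1 : Matrix n n ℝ)).PosSemidef := by
  have hM : (A - s • (1 : Matrix n n ℝ)).IsHermitian := by
    refine hA.isHermitian.sub ?_
    simp [Matrix.IsHermitian]
  refine hM.posSemidef_iff_eigenvalues_nonneg.2 fun i => ?_
  have hv := hM.mulVec_eigenvectorBasis i
  have hne : (hM.eigenvectorBasis i).ofLp ≠ 0 := by
    simpa using hM.eigenvectorBasis.orthonormal.ne_zero i
  generalize (hM.eigenvectorBasis i).ofLp = v at hv hne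
  generalize hM.eigenvalues i = t at hv ⊢
  have hAv : A.mulVec v = (t + s) • v := by
    rw [Matrix.sub_mulVec, Matrix.smul_mulVec, Matrix.one_mulVec, sub_eq_iff_eq_add] at hv
    rw [hv, add_smul]
  have hpos : 0 < v ⬝ᵥ v := by
    simpa using Matrix.dotProduct_star_self_pos_iff.2 hne
  have h1 := hA.dotProduct_mulVec_nonneg v
  have h2 := hA2.dotProduct_mulVec_nonneg v
  rw [hAv] at h1
  rw [Matrix.sub_mulVec, Matrix.smul_mulVec, Matrix.one_mulVec, ← Matrix.mulVec_mulVec, hAv,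
    Matrix.mulVec_smul, hAv] at h2
  simp only [star_trivial, dotProduct_smul, dotProduct_sub, smul_eq_mul] at h1 h2
  have h3 : 0 ≤ t + s := nonneg_of_mul_nonneg_left h1 hpos
  have h4 : 0 ≤ t * (t + s + s) := by
    refine nonneg_of_mul_nonneg_left (b := v ⬝ᵥ v) ?_ hpos
    linarith
  rw [Pi.zero_apply]
  by_contra! ht
  nlinarith

theorem frob_nonneg {d : ℕ} (A : Matrix (Fin d) (Fin d) ℝ) : 0 ≤ frob A := Real.sqrt_nonneg _

theorem trace_transpose_mul_eq_sum {d : ℕ} (A B : Matrix (Fin d) (Fin d) ℝ) :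
    (A.transpose * B).trace = ∑ p : Fin d × Fin d, A p.1 p.2 * B p.1 p.2 := by
  simp only [Matrix.trace, Matrix.diag_apply, Matrix.mul_apply, Matrix.transpose_apply]
  rw [Finset.sum_comm, Fintype.sum_prod_type]

theorem frob_eq_sqrt_sum {d : ℕ} (A : Matrix (Fin d) (Fin d) ℝ) :
    frob A = Real.sqrt (∑ p : Fin d × Fin d, A p.1 p.2 ^ 2) := by
  rw [frob, Fintype.sum_prod_type]

theorem trace_transpose_mul_self_eq_frob_sq {d : ℕ} (A : Matrix (Fin d) (Fin d) ℝ) :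
    (A.transpose * A).trace = frob A ^ 2 := by
  rw [trace_transpose_mul_eq_sum, frob_eq_sqrt_sum,
    Real.sq_sqrt (Finset.sum_nonneg fun _ _ => sq_nonneg _)]
  simp only [sq]

theorem trace_transpose_mul_le_frob_mul_frob {d : ℕ} (A B : Matrix (Fin d) (Fin d) ℝ) :
    (A.transpose * B).trace ≤ frob A * frob B := by
  rw [trace_transpose_mul_eq_sum, frob_eq_sqrt_sum, frob_eq_sqrt_sum]
  exact Real.sum_mul_le_sqrt_mul_sqrt _ _ _

theorem mul_frob_sq_le_trace {d : ℕ} {A D : Matrix (Fin d) (Fin d) ℝ} {s : ℝ}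
    (hA : (A - s • (1 : Matrix (Fin d) (Fin d) ℝ)).PosSemidef) :
    s * frob D ^ 2 ≤ (D.transpose * A * D).trace := by
  have h := (hA.conjTranspose_mul_mul_same D).trace_nonneg
  rw [Matrix.conjTranspose_eq_transpose_of_trivial, Matrix.mul_sub, Matrix.sub_mul,
    Matrix.trace_sub, Matrix.mul_smul, Matrix.smul_mul, Matrix.mul_one, Matrix.trace_smul,
    trace_transpose_mul_self_eq_frob_sq, smul_eq_mul] at h
  linarith

/-- The matrix square root is Lipschitz in the Frobenius norm away from singular matrices. -/
theorem two_mul_frob_sub_le {d : ℕ} {A B : Matrix (Fin d) (Fin d) ℝ} {s : ℝ}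
    (hA : (A - s • (1 : Matrix (Fin d) (Fin d) ℝ)).PosSemidef)
    (hB : (B - s • (1 : Matrix (Fin d) (Fin d) ℝ)).PosSemidef)
    (hD : (A - B).transpose = A - B) :
    2 * s * frob (A - B) ≤ frob (A * A - B * B) := by
  have hAD := mul_frob_sq_le_trace (D := A - B) hA
  have hBD := mul_frob_sq_le_trace (D := A - B) hB
  have hCS := trace_transpose_mul_le_frob_mul_frob (A - B) (A * A - B * B)
  have hexp : ((A - B).transpose * (A * A - B * B)).trace =
      ((A - B).transpose * A * (A - B)).trace + ((A - B).transpose * B * (A - B)).trace := by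
    rw [hD, Matrix.trace_mul_cycle (A - B) B (A - B), ← Matrix.trace_add]
    congr 1
    noncomm_ring
  rcases (frob_nonneg (A - B)).eq_or_lt with h0 | h0
  · rw [← h0, mul_zero]
    exact frob_nonneg _
  · refine le_of_mul_le_mul_left ?_ h0
    linarith

/-- If `θ` is positive-semidefinite-valued with `θ² ≥ δ·id` and `θ²` is `L`-Lipschitz, then `θ`
is Lipschitz, with constant depending only on `δ` and `L` (Remark 5.4 (ii)). -/
theorem statement10 (δ L : ℝ) (hδ : 0 < δ) (hL : 0 ≤ L) :
    ∃ C : ℝ, 0 < C ∧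
      ∀ (d : ℕ) (O : Set (Euc d)) (θ : Euc d → Matrix (Fin d) (Fin d) ℝ),
        (∀ x ∈ O, (θ x).PosSemidef) →
        (∀ x ∈ O, (θ x * θ x - δ • (1 : Matrix (Fin d) (Fin d) ℝ)).PosSemidef) →
        (∀ x ∈ O, ∀ y ∈ O, frob (θ x * θ x - θ y * θ y) ≤ L * ‖x - y‖) →
        ∀ x ∈ O, ∀ y ∈ O, frob (θ x - θ y) ≤ C * ‖x - y‖ := by
  have hs : 0 < Real.sqrt δ := Real.sqrt_pos.2 hδ
  refine ⟨L / (2 * Real.sqrt δ) + 1, by positivity, ?_⟩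
  intro d O θ hpos hsq hlip x hx y hy
  have key : ∀ z ∈ O, (θ z - Real.sqrt δ • (1 : Matrix (Fin d) (Fin d) ℝ)).PosSemidef := by
    intro z hz
    refine posSemidef_sub_smul_one_of_sq (hpos z hz) ?_
    rw [Real.mul_self_sqrt hδ.le]
    exact hsq z hz
  have hD : (θ x - θ y).transpose = θ x - θ y := by
    rw [← Matrix.conjTranspose_eq_transpose_of_trivial]
    exact (hpos x hx).isHermitian.sub (hpos y hy).isHermitian
  have h := (two_mul_frob_sub_le (key x hx) (key y hy) hD).trans (hlip x hx y hy)
  calc frob (θ x - θ y) ≤ L * ‖x - y‖ / (2 * Real.sqrt δ) := by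
        rw [le_div_iff₀ (by positivity)]
        linarith
    _ = L / (2 * Real.sqrt δ) * ‖x - y‖ := by ring
    _ ≤ (L / (2 * Real.sqrt δ) + 1) * ‖x - y‖ := by
        gcongr
        linarith
end
end
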